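/- The number of monotone Boolean functions of 8 variables that are fixed points of the permutation of Fin 8 given by the product of transpositions (0 1)(2 3) equals 182755441509724. -/

import Mathlib

/-- The monotone Boolean functions of four variables. -/
abbrev MBF₄ : Type := (Fin 4 → Bool) →o Bool

/-- The input whose first four coordinates are `a b c d` and whose last four are `y`. -/
def headTail (a b c d : Bool) (y : Fin 4 → Bool) : Fin 8 → Bool :=
  ![a, b, c, d, y 0, y 1, y 2, y 3]

/-- The last four coordinates of an input. -/
def inputTail (x : Fin 8 → Bool) : Fin 4 → Bool := ![x 4, x 5, x 6, x 7]

theorem headTail_inputTail (x : Fin 8 → Bool) :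
    headTail (x 0) (x 1) (x 2) (x 3) (inputTail x) = x := by
  funext i; fin_cases i <;> rfl

theorem inputTail_headTail (a b c d : Bool) (y : Fin 4 → Bool) :
    inputTail (headTail a b c d y) = y := by
  funext i; fin_cases i <;> rfl

theorem headTail_mono {a b c d a' b' c' d' : Bool} {y y' : Fin 4 → Bool} (ha : a ≤ a')
    (hb : b ≤ b') (hc : c ≤ c') (hd : d ≤ d') (hy : y ≤ y') :
    headTail a b c d y ≤ headTail a' b' c' d' y' := by
  intro i; fin_cases i
  exacts [ha, hb, hc, hd, hy 0, hy 1, hy 2, hy 3]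

theorem inputTail_mono {x x' : Fin 8 → Bool} (h : x ≤ x') : inputTail x ≤ inputTail x' := by
  intro i; fin_cases i
  exacts [h 4, h 5, h 6, h 7]

theorem headTail_comp_swap (a b c d : Bool) (y : Fin 4 → Bool) :
    headTail a b c d y ∘ (Equiv.swap 0 1 * Equiv.swap 2 3 : Equiv.Perm (Fin 8)) =
      headTail b a d c y := by
  funext i; fin_cases i <;> rfl

/-- Monotone maps from `{0,1}⁴` to `T` invariant under swapping coordinates `0, 1` and `2, 3`. -/
structure SwapInvariantMap (T : Type*) [Preorder T] where
  toFun : Bool → Bool → Bool → Bool → T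
  mono : ∀ {a b c d a' b' c' d' : Bool}, a ≤ a' → b ≤ b' → c ≤ c' → d ≤ d' →
    toFun a b c d ≤ toFun a' b' c' d'
  swap : ∀ a b c d, toFun a b c d = toFun b a d c

theorem SwapInvariantMap.ext {T : Type*} [Preorder T] {F G : SwapInvariantMap T}
    (h : ∀ a b c d, F.toFun a b c d = G.toFun a b c d) : F = G := by
  obtain ⟨F, _, _⟩ := F
  obtain ⟨G, _, _⟩ := G
  obtain rfl : F = G := by funext a b c d; exact h a b c d
  rfl

/-- A fixed monotone Boolean function of eight variables is a swap-invariant map into the lattice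
of monotone Boolean functions of the last four variables. -/
def fixedEquivSwapInvariantMap :
    {f : (Fin 8 → Bool) → Bool // Monotone f ∧ ∀ x : Fin 8 → Bool,
      f (x ∘ (Equiv.swap 0 1 * Equiv.swap 2 3 : Equiv.Perm (Fin 8))) = f x} ≃
    SwapInvariantMap MBF₄ where
  toFun f :=
    { toFun a b c d := ⟨fun y => f.1 (headTail a b c d y), fun _ _ h =>
        f.2.1 (headTail_mono le_rfl le_rfl le_rfl le_rfl h)⟩
      mono ha hb hc hd _ := f.2.1 (headTail_mono ha hb hc hd le_rfl)
      swap a b c d := by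
        ext y
        change f.1 _ = f.1 _
        rw [← f.2.2, headTail_comp_swap] }
  invFun F := ⟨fun x => F.toFun (x 0) (x 1) (x 2) (x 3) (inputTail x), fun x x' h =>
      (F.mono (h 0) (h 1) (h 2) (h 3) _).trans ((F.toFun _ _ _ _).2 (inputTail_mono h)), fun x => by
    rw [← headTail_inputTail x, headTail_comp_swap]
    simp only [inputTail_headTail]
    exact congrArg (fun m : MBF₄ => m _) (F.swap _ _ _ _)⟩
  left_inv f := by
    apply Subtype.ext
    funext x
    exact congrArg f.1 (headTail_inputTail x)
  right_inv F := by
    refine SwapInvariantMap.ext fun a b c d => ?_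
    ext y
    exact congrArg (F.toFun a b c d) (inputTail_headTail a b c d y)

/-- The values of a swap-invariant map on the ten orbits: those on `1000`, `0010`, `1110`, `1011`,
and then, in the intervals they determine, those on `0000`, `1111`, `1100`, `0011`, `1010`,
`1001`. -/
abbrev OrbitValues (T : Type*) [Lattice T] [BoundedOrder T] := Σ x : T × T × T × T,
  Set.Icc ⊥ (x.1 ⊓ x.2.1) × Set.Icc (x.2.2.1 ⊔ x.2.2.2) ⊤ ×
  Set.Icc x.1 x.2.2.1 × Set.Icc x.2.1 x.2.2.2 ×
  Set.Icc (x.1 ⊔ x.2.1) (x.2.2.1 ⊓ x.2.2.2) × Set.Icc (x.1 ⊔ x.2.1) (x.2.2.1 ⊓ x.2.2.2)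

section
variable {T : Type*} [Lattice T] [BoundedOrder T]

/-- The map `{0,1}⁴ → T` with the given values on the orbits. -/
def OrbitValues.toFun (t : OrbitValues T) : Bool → Bool → Bool → Bool → T
  | false, false, false, false => t.2.1
  | true, false, false, false => t.1.1
  | false, true, false, false => t.1.1
  | false, false, true, false => t.1.2.1
  | false, false, false, true => t.1.2.1
  | true, true, false, false => t.2.2.2.1
  | false, false, true, true => t.2.2.2.2.1
  | true, false, true, false => t.2.2.2.2.2.1
  | false, true, false, true => t.2.2.2.2.2.1
  | true, false, false, true => t.2.2.2.2.2.2
  | false, true, true, false => t.2.2.2.2.2.2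
  | true, true, true, false => t.1.2.2.1
  | true, true, false, true => t.1.2.2.1
  | true, false, true, true => t.1.2.2.2
  | false, true, true, true => t.1.2.2.2
  | true, true, true, true => t.2.2.1

theorem OrbitValues.toFun_swap (t : OrbitValues T) (a b c d : Bool) :
    t.toFun a b c d = t.toFun b a d c := by
  revert a b c d
  rintro (_ | _) (_ | _) (_ | _) (_ | _) <;> rfl

theorem OrbitValues.toFun_le_true_left (t : OrbitValues T) (b c d : Bool) :
    t.toFun false b c d ≤ t.toFun true b c d := by
  obtain ⟨⟨x, y, z, w⟩, ⟨o, _, ho⟩, ⟨i, hi, _⟩, ⟨p, hp, hp'⟩, ⟨q, hq, hq'⟩, ⟨r, hr, hr'⟩,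
    ⟨s, hs, hs'⟩⟩ := t
  have ho := le_inf_iff.1 ho
  have hi := sup_le_iff.1 hi
  have hr := sup_le_iff.1 hr
  have hs := sup_le_iff.1 hs
  have hr' := le_inf_iff.1 hr'
  have hs' := le_inf_iff.1 hs'
  revert b c d
  rintro (_ | _) (_ | _) (_ | _)
  exacts [ho.1, hs.2, hr.2, hq', hp, hr'.1, hs'.1, hi.2]

theorem OrbitValues.toFun_le_true_right (t : OrbitValues T) (a b d : Bool) :
    t.toFun a b false d ≤ t.toFun a b true d := by
  obtain ⟨⟨x, y, z, w⟩, ⟨o, _, ho⟩, ⟨i, hi, _⟩, ⟨p, hp, hp'⟩, ⟨q, hq, hq'⟩, ⟨r, hr, hr'⟩,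
    ⟨s, hs, hs'⟩⟩ := t
  have ho := le_inf_iff.1 ho
  have hi := sup_le_iff.1 hi
  have hr := sup_le_iff.1 hr
  have hs := sup_le_iff.1 hs
  have hr' := le_inf_iff.1 hr'
  have hs' := le_inf_iff.1 hs'
  revert a b d
  rintro (_ | _) (_ | _) (_ | _)
  exacts [ho.2, hq, hs.1, hr'.2, hr.1, hs'.2, hp', hi.1]

theorem OrbitValues.toFun_mono (t : OrbitValues T) {a b c d a' b' c' d' : Bool} (ha : a ≤ a')
    (hb : b ≤ b') (hc : c ≤ c') (hd : d ≤ d') : t.toFun a b c d ≤ t.toFun a' b' c' d' := by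
  have left : ∀ {a a'} b c d, a ≤ a' → t.toFun a b c d ≤ t.toFun a' b c d := by
    rintro (_ | _) (_ | _) b c d h
    exacts [le_rfl, t.toFun_le_true_left b c d, absurd h (by decide), le_rfl]
  have right : ∀ a b {c c'} d, c ≤ c' → t.toFun a b c d ≤ t.toFun a b c' d := by
    rintro a b (_ | _) (_ | _) d h
    exacts [le_rfl, t.toFun_le_true_right a b d, absurd h (by decide), le_rfl]
  calc t.toFun a b c d ≤ t.toFun a' b c d := left _ _ _ ha
    _ ≤ t.toFun a' b c' d := right _ _ _ hc
    _ = t.toFun b a' d c' := t.toFun_swap _ _ _ _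
    _ ≤ t.toFun b' a' d c' := left _ _ _ hb
    _ ≤ t.toFun b' a' d' c' := right _ _ _ hd
    _ = t.toFun a' b' c' d' := t.toFun_swap _ _ _ _

/-- The values of a swap-invariant map on the orbits. -/
def SwapInvariantMap.orbitValues (F : SwapInvariantMap T) : OrbitValues T :=
  have mono : ∀ a b c d a' b' c' d', a ≤ a' ∧ b ≤ b' ∧ c ≤ c' ∧ d ≤ d' →
      F.toFun a b c d ≤ F.toFun a' b' c' d' :=
    fun _ _ _ _ _ _ _ _ h => F.mono h.1 h.2.1 h.2.2.1 h.2.2.2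
  have swapped : ∀ a b c d a' b' c' d', b ≤ a' ∧ a ≤ b' ∧ d ≤ c' ∧ c ≤ d' →
      F.toFun a b c d ≤ F.toFun a' b' c' d' :=
    fun a b c d _ _ _ _ h => (F.swap a b c d).trans_le (mono _ _ _ _ _ _ _ _ h)
  ⟨⟨F.toFun true false false false, F.toFun false false true false,
      F.toFun true true true false, F.toFun true false true true⟩,
    ⟨F.toFun false false false false, bot_le,
      le_inf (mono _ _ _ _ _ _ _ _ (by decide)) (mono _ _ _ _ _ _ _ _ (by decide))⟩,
    ⟨F.toFun true true true true,
      sup_le (mono _ _ _ _ _ _ _ _ (by decide)) (mono _ _ _ _ _ _ _ _ (by decide)), le_top⟩,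
    ⟨F.toFun true true false false, mono _ _ _ _ _ _ _ _ (by decide),
      mono _ _ _ _ _ _ _ _ (by decide)⟩,
    ⟨F.toFun false false true true, mono _ _ _ _ _ _ _ _ (by decide),
      mono _ _ _ _ _ _ _ _ (by decide)⟩,
    ⟨F.toFun true false true false,
      sup_le (mono _ _ _ _ _ _ _ _ (by decide)) (mono _ _ _ _ _ _ _ _ (by decide)),
      le_inf (mono _ _ _ _ _ _ _ _ (by decide)) (mono _ _ _ _ _ _ _ _ (by decide))⟩,
    ⟨F.toFun true false false true,
      sup_le (mono _ _ _ _ _ _ _ _ (by decide)) (swapped _ _ _ _ _ _ _ _ (by decide)),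
      le_inf (swapped _ _ _ _ _ _ _ _ (by decide)) (mono _ _ _ _ _ _ _ _ (by decide))⟩⟩

/-- A swap-invariant map is determined by its values on the ten orbits. -/
def swapInvariantMapEquiv : SwapInvariantMap T ≃ OrbitValues T where
  toFun := SwapInvariantMap.orbitValues
  invFun t := ⟨t.toFun, t.toFun_mono, t.toFun_swap⟩
  left_inv F := by
    apply SwapInvariantMap.ext
    rintro (_ | _) (_ | _) (_ | _) (_ | _)
    all_goals first | rfl | exact F.swap _ _ _ _
  right_inv t := rfl

/-- The number of elements of an interval. -/
noncomputable def intervalCard (x y : T) : ℕ := Nat.card (Set.Icc x y)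

theorem card_swapInvariantMap [Fintype T] :
    Nat.card (SwapInvariantMap T) = ∑ a : T, ∑ b : T, ∑ e : T, ∑ g : T,
      intervalCard ⊥ (a ⊓ b) * (intervalCard (e ⊔ g) ⊤ * (intervalCard a e * (intervalCard b g *
        (intervalCard (a ⊔ b) (e ⊓ g) * intervalCard (a ⊔ b) (e ⊓ g))))) := by
  rw [Nat.card_congr swapInvariantMapEquiv, Nat.card_sigma]
  simp only [Nat.card_prod, Fintype.sum_prod_type, intervalCard]
end

/-- The truth tables of the monotone Boolean functions of four variables, as 16-bit numbers. -/
def monotoneCodes : List ℕ := [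
  0, 32768, 32896, 34816, 34944, 34952, 40960, 41088, 41120, 43008, 43136, 43144, 43168, 43176,
  43520, 43648, 43656, 43680, 43688, 43690, 49152, 49280, 49344, 51200, 51328, 51336, 51392,
  51400, 52224, 52352, 52360, 52416, 52424, 52428, 57344, 57472, 57504, 57536, 57568, 59392,
  59520, 59528, 59552, 59560, 59584, 59592, 59616, 59624, 59904, 60032, 60040, 60064, 60072,
  60074, 60096, 60104, 60128, 60136, 60138, 60416, 60544, 60552, 60576, 60584, 60608, 60616,
  60620, 60640, 60648, 60652, 60928, 61056, 61064, 61088, 61096, 61098, 61120, 61128, 61132,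
  61152, 61160, 61162, 61164, 61166, 61440, 61568, 61600, 61632, 61664, 61680, 63488, 63616,
  63624, 63648, 63656, 63680, 63688, 63712, 63720, 63728, 63736, 64000, 64128, 64136, 64160,
  64168, 64170, 64192, 64200, 64224, 64232, 64234, 64240, 64248, 64250, 64512, 64640, 64648,
  64672, 64680, 64704, 64712, 64716, 64736, 64744, 64748, 64752, 64760, 64764, 65024, 65152,
  65160, 65184, 65192, 65194, 65216, 65224, 65228, 65248, 65256, 65258, 65260, 65262, 65264,
  65272, 65274, 65276, 65278, 65280, 65408, 65416, 65440, 65448, 65450, 65472, 65480, 65484,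
  65504, 65512, 65514, 65516, 65518, 65520, 65528, 65530, 65532, 65534, 65535]

/-- The table behind `digitOffset`: its 16-bit entry at `x % 1121` is the offset of `x`. -/
noncomputable def offsetTable : ℕ :=
  List.rec (fun _ => 0)
    (fun x _ ih i => Nat.add (Nat.shiftLeft i (Nat.mul 16 (Nat.mod x 1121))) (ih (Nat.add i 40)))
    monotoneCodes 0

/-- Sum of `f` over a list, with operations that the kernel evaluates fast. -/
noncomputable def listSum (f : ℕ → ℕ) (l : List ℕ) : ℕ :=
  List.rec 0 (fun x _ ih => Nat.add (f x) ih) l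

/-- The sublist of the elements satisfying `p`. -/
noncomputable def listFilter (p : ℕ → Bool) (l : List ℕ) : List ℕ :=
  List.rec [] (fun x _ ih => Bool.rec ih (x :: ih) (p x)) l

/-- Inclusion of bit sets. -/
def bitsLE (a b : ℕ) : Bool := Nat.beq (Nat.land a b) a

/-- The bit position at which the entry of `x` starts in a packed vector. -/
noncomputable def digitOffset (x : ℕ) : ℕ :=
  Nat.land (Nat.shiftRight offsetTable (Nat.mul 16 (Nat.mod x 1121))) 65535

/-- The entry of `x` in a packed vector, whose entries have 40 bits. -/
noncomputable def digit (N x : ℕ) : ℕ := Nat.mod (Nat.shiftRight N (digitOffset x)) 1099511627776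

/-- The truth tables above `s`. -/
noncomputable def codesAbove (s : ℕ) : List ℕ := listFilter (fun x => bitsLE s x) monotoneCodes

/-- The truth tables below `s`. -/
noncomputable def codesBelow (s : ℕ) : List ℕ := listFilter (fun x => bitsLE x s) monotoneCodes

/-- The packed indicator vector of the elements above `s`. -/
noncomputable def aboveVector (s : ℕ) : ℕ :=
  listSum (fun x => Nat.shiftLeft 1 (digitOffset x)) (codesAbove s)

/-- The packed vector of the cardinalities of the intervals starting at `s`. -/
noncomputable def intervalVector (s : ℕ) : ℕ := listSum aboveVector (codesAbove s)

/-- The packed vector of the numbers of elements above. -/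
noncomputable def upperCardVector : ℕ :=
  listSum (fun x => Nat.shiftLeft (listSum (fun _ => 1) (codesAbove x)) (digitOffset x))
    monotoneCodes

/-- The packed vector whose entry at `g` is the sum, over the `b` with `a ⊔ b = s`, of the number of
elements below `a ⊓ b` times the size of the interval from `b` to `g`. -/
noncomputable def joinVector (s a : ℕ) : ℕ :=
  listSum (fun b => Bool.rec 0
    (Nat.mul (digit (intervalVector 0) (Nat.land a b)) (intervalVector b))
    (Nat.beq (Nat.lor a b) s)) (codesBelow s)

/-- The packed vector whose entry at `g` counts the values on `1000`, `0010`, `0000`, `1100`, `0011`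
with join `s` of the first two, given the values `e` and `g` on `1110` and `1011`. -/
noncomputable def lowerVector (s e : ℕ) : ℕ :=
  listSum (fun a => Nat.mul (digit (intervalVector a) e) (joinVector s a)) (codesBelow s)

/-- The number of orbit values for which the join of the values on `1000` and `0010` is `s`. -/
noncomputable def countWithJoin (s : ℕ) : ℕ :=
  listSum (fun e => listSum (fun g =>
    Nat.mul (digit upperCardVector (Nat.lor e g))
      (Nat.mul (Nat.mul (digit (intervalVector s) (Nat.land e g))
        (digit (intervalVector s) (Nat.land e g))) (digit (lowerVector s e) g)))
    (codesAbove s)) (codesAbove s)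

/-- A test for monotonicity of a truth table. -/
def isMonotoneCode (n : ℕ) : Bool :=
  bitsLE (Nat.shiftLeft (Nat.land n 255) 8) n && (bitsLE (Nat.shiftLeft (Nat.land n 3855) 4) n &&
    (bitsLE (Nat.shiftLeft (Nat.land n 13107) 2) n &&
      bitsLE (Nat.shiftLeft (Nat.land n 21845) 1) n))

theorem listSum_eq (f : ℕ → ℕ) (l : List ℕ) : listSum f l = (l.map f).sum := by
  induction l with
  | nil => rfl
  | cons x l ih => rw [List.map_cons, List.sum_cons, ← ih]; rfl

theorem listSum_listFilter (f : ℕ → ℕ) (p : ℕ → Bool) (l : List ℕ) :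
    listSum f (listFilter p l) = listSum (fun x => if p x then f x else 0) l := by
  induction l with
  | nil => rfl
  | cons x l ih =>
    change listSum f (Bool.rec (listFilter p l) (x :: listFilter p l) (p x)) =
      (if p x then f x else 0) + listSum (fun x => if p x then f x else 0) l
    rw [← ih]
    cases p x
    · exact (Nat.zero_add _).symm
    · rfl

theorem bitsLE_iff {a b : ℕ} : bitsLE a b = true ↔ ∀ i, a.testBit i = true → b.testBit i = true := by
  rw [bitsLE, Nat.beq_eq]
  constructor
  · intro h i hi
    have h : a &&& b = a := h
    rw [← h, Nat.testBit_and, Bool.and_eq_true] at hi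
    exact hi.2
  · intro h
    refine Nat.eq_of_testBit_eq fun i => ?_
    change (a &&& b).testBit i = _
    rw [Nat.testBit_and]
    have := h i
    grind

theorem mem_monotoneCodes_of_isMonotoneCode {n : ℕ} (hn : n < 65536) (h : isMonotoneCode n = true) :
    n ∈ monotoneCodes := by
  have key : (List.range 256).all (fun i => (List.range 256).all fun j =>
      !(isMonotoneCode (Nat.add (Nat.mul 256 i) j)) ||
        monotoneCodes.any (Nat.beq (Nat.add (Nat.mul 256 i) j))) = true := by decide +kernel
  rw [List.all_eq_true] at key
  have key := key (n / 256) (List.mem_range.2 (by omega))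
  rw [List.all_eq_true] at key
  have key := key (n % 256) (List.mem_range.2 (by omega))
  have e : Nat.add (Nat.mul 256 (n / 256)) (n % 256) = n := Nat.div_add_mod n 256
  rw [e, h] at key
  simpa using key

theorem nodup_monotoneCodes : monotoneCodes.Nodup := by decide +kernel

theorem map_digitOffset_monotoneCodes :
    monotoneCodes.map digitOffset = (List.range' 0 168).map (40 * ·) := by decide +kernel

/-- The truth table of a function as a number. -/
def truthTable (m : MBF₄) : ℕ :=
  Nat.ofBits fun j : Fin 16 => m fun i => j.val.testBit i

theorem testBit_ofBits_input (x : Fin 4 → Bool) : (fun i : Fin 4 => (Nat.ofBits x).testBit i) = x := by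
  funext i
  exact Nat.testBit_ofBits_lt x i i.2

theorem testBit_truthTable (m : MBF₄) (x : Fin 4 → Bool) :
    (truthTable m).testBit (Nat.ofBits x) = m x := by
  rw [truthTable, Nat.testBit_ofBits_lt _ _ (Nat.ofBits_lt_two_pow x)]
  exact congrArg m (testBit_ofBits_input x)

theorem truthTable_injective : Function.Injective truthTable := by
  intro m m' h
  ext x
  rw [← testBit_truthTable, h, testBit_truthTable]

theorem truthTable_inf (m m' : MBF₄) :
    truthTable (m ⊓ m') = Nat.land (truthTable m) (truthTable m') := by
  refine Nat.eq_of_testBit_eq fun j => ?_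
  change _ = (truthTable m &&& truthTable m').testBit j
  rw [Nat.testBit_and]
  by_cases hj : j < 16
  · simp only [truthTable, Nat.testBit_ofBits_lt _ _ hj]; rfl
  · simp only [truthTable, Nat.testBit_ofBits_ge _ _ (not_lt.1 hj)]; rfl

theorem truthTable_sup (m m' : MBF₄) :
    truthTable (m ⊔ m') = Nat.lor (truthTable m) (truthTable m') := by
  refine Nat.eq_of_testBit_eq fun j => ?_
  change _ = (truthTable m ||| truthTable m').testBit j
  rw [Nat.testBit_or]
  by_cases hj : j < 16
  · simp only [truthTable, Nat.testBit_ofBits_lt _ _ hj]; rfl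
  · simp only [truthTable, Nat.testBit_ofBits_ge _ _ (not_lt.1 hj)]; rfl

theorem truthTable_bot : truthTable ⊥ = 0 := by
  decide +kernel

theorem bitsLE_truthTable {m m' : MBF₄} :
    bitsLE (truthTable m) (truthTable m') = true ↔ m ≤ m' := by
  rw [bitsLE, Nat.beq_eq, ← truthTable_inf, truthTable_injective.eq_iff, inf_eq_left]

theorem bitsLE_shiftLeft_truthTable (m : MBF₄) {mask k : ℕ}
    (h : ∀ j < 16, mask.testBit j = true → j + k < 16 ∧
      ∀ i : Fin 4, j.testBit i = true → (j + k).testBit i = true) :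
    bitsLE (Nat.shiftLeft (Nat.land (truthTable m) mask) k) (truthTable m) = true := by
  rw [bitsLE_iff]
  intro i hi
  change ((truthTable m &&& mask) <<< k).testBit i = true at hi
  rw [Nat.testBit_shiftLeft, Nat.testBit_and, Bool.and_eq_true, Bool.and_eq_true,
    decide_eq_true_eq] at hi
  obtain ⟨hik, htrue, hmask⟩ := hi
  obtain ⟨j, rfl⟩ := Nat.exists_eq_add_of_le' hik
  rw [Nat.add_sub_cancel] at htrue hmask
  by_cases hj : j < 16
  · rw [truthTable, Nat.testBit_ofBits_lt _ _ hj] at htrue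
    rw [truthTable, Nat.testBit_ofBits_lt _ _ (h j hj hmask).1]
    exact m.2 (fun i => (h j hj hmask).2 i) htrue
  · rw [truthTable, Nat.testBit_ofBits_ge _ _ (not_lt.1 hj)] at htrue
    exact absurd htrue (by decide)

theorem truthTable_mem_monotoneCodes (m : MBF₄) :
    truthTable m ∈ monotoneCodes := by
  have hlt : truthTable m < 2 ^ 16 := Nat.ofBits_lt_two_pow _
  refine mem_monotoneCodes_of_isMonotoneCode hlt ?_
  simp only [isMonotoneCode, Bool.and_eq_true]
  refine ⟨?_, ?_, ?_, ?_⟩ <;> exact bitsLE_shiftLeft_truthTable m (by decide +kernel)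

theorem exists_truthTable_eq {n : ℕ} (hn : n ∈ monotoneCodes) :
    ∃ m : MBF₄, truthTable m = n := by
  have key : (List.range 16).all (fun i => (List.range 16).all fun j => !(bitsLE i j) ||
      monotoneCodes.all fun n => !(n.testBit i) || n.testBit j) = true := by decide +kernel
  have hlt : n < 2 ^ 16 := by
    have : ∀ n ∈ monotoneCodes, n < 2 ^ 16 := by decide +kernel
    exact this n hn
  refine ⟨⟨fun x => n.testBit (Nat.ofBits x), fun x y hxy => ?_⟩, ?_⟩
  · have hbits : bitsLE (Nat.ofBits x) (Nat.ofBits y) = true := by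
      rw [bitsLE_iff]
      intro i hi
      by_cases hi4 : i < 4
      · rw [Nat.testBit_ofBits_lt _ _ hi4] at hi ⊢
        exact hxy _ hi
      · rw [Nat.testBit_ofBits_ge _ _ (not_lt.1 hi4)] at hi
        exact absurd hi (by decide)
    rw [List.all_eq_true] at key
    have key := key _ (List.mem_range.2 (Nat.ofBits_lt_two_pow x))
    rw [List.all_eq_true] at key
    have key := key _ (List.mem_range.2 (Nat.ofBits_lt_two_pow y))
    rw [hbits, Bool.not_true, Bool.false_or, List.all_eq_true] at key
    have key := key n hn
    intro h
    change n.testBit _ = true at h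
    rwa [h, Bool.not_true, Bool.false_or] at key
  · refine Nat.eq_of_testBit_eq fun j => ?_
    by_cases hj : j < 16
    · rw [truthTable, Nat.testBit_ofBits_lt _ _ hj]
      change n.testBit (Nat.ofBits fun i : Fin 4 => j.testBit i) = _
      congr 1
      refine Nat.eq_of_testBit_eq fun i => ?_
      by_cases hi : i < 4
      · rw [Nat.testBit_ofBits_lt _ _ hi]
      · rw [Nat.testBit_ofBits_ge _ _ (not_lt.1 hi)]
        exact (Nat.testBit_lt_two_pow (hj.trans_le (Nat.pow_le_pow_right two_pos (not_lt.1 hi)))).symm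
    · rw [truthTable, Nat.testBit_ofBits_ge _ _ (not_lt.1 hj)]
      exact (Nat.testBit_lt_two_pow (hlt.trans_le (Nat.pow_le_pow_right two_pos (not_lt.1 hj)))).symm

theorem sum_map_mul_pow {g : ℕ → ℕ} (v : ℕ → ℕ) {l : List ℕ} {k : ℕ}
    (h : l.map g = (List.range' k l.length).map (40 * ·)) :
    (l.map fun x => v x * 2 ^ g x).sum = (2 ^ 40) ^ k * Nat.ofDigits (2 ^ 40) (l.map v) := by
  induction l generalizing k with
  | nil => simp
  | cons x l ih =>
    simp only [List.map_cons, List.length_cons, List.range'_succ, List.cons.injEq] at h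
    rw [List.map_cons, List.sum_cons, List.map_cons, Nat.ofDigits_cons, ih h.2, h.1, pow_mul]
    push_cast
    ring

theorem ofDigits_div_pow_mod {B : ℕ} {l : List ℕ} (hl : ∀ x ∈ l, x < B) {i : ℕ}
    (hi : i < l.length) : Nat.ofDigits B l / B ^ i % B = l[i] := by
  have hB : 0 < B := (Nat.zero_le _).trans_lt (hl l[i] (List.getElem_mem hi))
  induction l generalizing i with
  | nil => simp at hi
  | cons x l ih =>
    have hx := hl x List.mem_cons_self
    rw [Nat.ofDigits_cons]
    cases i with
    | zero => simp [Nat.add_mul_mod_self_left, Nat.mod_eq_of_lt hx]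
    | succ i =>
      rw [pow_succ', ← Nat.div_div_eq_div_mul, Nat.add_mul_div_left _ _ hB,
        Nat.div_eq_of_lt hx, zero_add, List.getElem_cons_succ]
      exact ih (fun y hy => hl y (List.mem_cons_of_mem _ hy)) _

theorem intervalCard_eq_zero {T : Type*} [Lattice T] {s t : T} (h : ¬s ≤ t) :
    intervalCard s t = 0 := by
  rw [intervalCard, Set.Icc_eq_empty h, Nat.card_of_isEmpty]

theorem sum_sum_sum_sum_comm {ι : Type*} [Fintype ι] (F : ι → ι → ι → ι → ℕ) :
    ∑ a, ∑ b, ∑ e, ∑ g, F a b e g = ∑ e, ∑ g, ∑ a, ∑ b, F a b e g := by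
  simp only [← Fintype.sum_prod_type' (f := fun e g => F _ _ e g)]
  simp only [← Fintype.sum_prod_type' (f := fun a b => ∑ p : ι × ι, F a b p.1 p.2)]
  rw [Finset.sum_comm, Fintype.sum_prod_type]
  simp only [Fintype.sum_prod_type]

section
variable [Fintype MBF₄]

theorem listSum_monotoneCodes (f : ℕ → ℕ) :
    listSum f monotoneCodes = ∑ m : MBF₄, f (truthTable m) := by
  classical
  have : monotoneCodes.toFinset = Finset.univ.image truthTable := by
    ext n
    simp only [List.mem_toFinset, Finset.mem_image, Finset.mem_univ, true_and]
    exact ⟨exists_truthTable_eq, fun ⟨m, hm⟩ => hm ▸ truthTable_mem_monotoneCodes m⟩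
  rw [listSum_eq, ← List.sum_toFinset _ nodup_monotoneCodes, this,
    Finset.sum_image truthTable_injective.injOn]

theorem card_mbf : Fintype.card MBF₄ = 168 := by
  have := listSum_monotoneCodes fun _ => 1
  rw [Finset.sum_const, smul_eq_mul, mul_one, Finset.card_univ] at this
  rw [← this]
  decide +kernel

open Classical in
theorem listSum_codesAbove (f : ℕ → ℕ) (s : MBF₄) :
    listSum f (codesAbove (truthTable s)) = ∑ m : MBF₄, if s ≤ m then f (truthTable m) else 0 := by
  rw [codesAbove, listSum_listFilter, listSum_monotoneCodes]
  simp only [bitsLE_truthTable]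

open Classical in
theorem listSum_codesBelow (f : ℕ → ℕ) (s : MBF₄) :
    listSum f (codesBelow (truthTable s)) = ∑ m : MBF₄, if m ≤ s then f (truthTable m) else 0 := by
  rw [codesBelow, listSum_listFilter, listSum_monotoneCodes]
  simp only [bitsLE_truthTable]

/-- The number whose 40-bit digits are the values of `v`. -/
noncomputable def packed (v : MBF₄ → ℕ) : ℕ := ∑ m, v m * 2 ^ digitOffset (truthTable m)

theorem digit_packed {v : MBF₄ → ℕ} (hv : ∀ m, v m < 2 ^ 40) (m : MBF₄) :
    digit (packed v) (truthTable m) = v m := by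
  set w : ℕ → ℕ := fun n => v (Function.invFun truthTable n) with hw
  have hwv : ∀ m, w (truthTable m) = v m := fun m =>
    congrArg v (Function.leftInverse_invFun truthTable_injective m)
  have hpacked : packed v = Nat.ofDigits (2 ^ 40) (monotoneCodes.map w) := by
    have := sum_map_mul_pow w map_digitOffset_monotoneCodes
    rw [pow_zero, one_mul] at this
    rw [← this, ← listSum_eq, listSum_monotoneCodes, packed]
    simp only [hwv]
  obtain ⟨i, hi, him⟩ := List.getElem_of_mem (truthTable_mem_monotoneCodes m)
  have hoffset : digitOffset (truthTable m) = 40 * i := by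
    have : (monotoneCodes.map digitOffset)[i]'(by simpa using hi) = 40 * i := by
      simp [map_digitOffset_monotoneCodes]
    rwa [List.getElem_map, him] at this
  have hdigit : digit (packed v) (truthTable m) = packed v / (2 ^ 40) ^ i % 2 ^ 40 := by
    rw [digit, hoffset, ← pow_mul, ← Nat.shiftRight_eq_div_pow]
    rfl
  rw [hdigit, hpacked, ofDigits_div_pow_mod ?_ (by simpa using hi), List.getElem_map,
    him, hwv]
  rintro _ hx
  obtain ⟨n, -, rfl⟩ := List.mem_map.1 hx
  exact hv _

theorem sum_le_mul_of_le {v : MBF₄ → ℕ} {c : ℕ} (hv : ∀ m, v m ≤ c) : ∑ m, v m ≤ 168 * c := by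
  rw [← card_mbf, ← smul_eq_mul]
  exact Finset.sum_le_card_nsmul _ _ _ fun m _ => hv m

theorem intervalCard_le (s t : MBF₄) : intervalCard s t ≤ 168 := by
  rw [← card_mbf, ← Nat.card_eq_fintype_card]
  exact Nat.card_le_card_of_injective _ Subtype.val_injective

open Classical in
theorem intervalCard_eq_sum (s t : MBF₄) :
    intervalCard s t = ∑ m : MBF₄, if s ≤ m then if m ≤ t then 1 else 0 else 0 := by
  simp only [← ite_and, Finset.sum_boole, Nat.cast_id]
  rw [intervalCard, Nat.card_eq_fintype_card, Fintype.card_subtype]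
  simp only [Set.mem_Icc]

theorem packed_sum {ι : Type*} (s : Finset ι) (v : ι → MBF₄ → ℕ) :
    ∑ i ∈ s, packed (v i) = packed fun m => ∑ i ∈ s, v i m := by
  simp only [packed, Finset.sum_mul]
  exact Finset.sum_comm

theorem mul_packed (c : ℕ) (v : MBF₄ → ℕ) : c * packed v = packed fun m => c * v m := by
  simp only [packed, Finset.mul_sum, mul_assoc]

theorem ite_packed (p : Prop) [Decidable p] (v : MBF₄ → ℕ) :
    (if p then packed v else 0) = packed fun m => if p then v m else 0 := by
  split_ifs
  · rfl
  · simp [packed]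

open Classical in
theorem aboveVector_eq (s : MBF₄) :
    aboveVector (truthTable s) = packed fun m => if s ≤ m then 1 else 0 := by
  rw [aboveVector, listSum_codesAbove, packed]
  refine Finset.sum_congr rfl fun m _ => ?_
  change (if s ≤ m then 1 <<< digitOffset (truthTable m) else 0) = _
  rw [Nat.shiftLeft_eq, ite_mul, zero_mul]

theorem intervalVector_eq (s : MBF₄) : intervalVector (truthTable s) = packed (intervalCard s) := by
  classical
  rw [intervalVector, listSum_codesAbove]
  simp only [aboveVector_eq, ite_packed, packed_sum]
  congr 1
  funext t
  exact (intervalCard_eq_sum s t).symm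

theorem upperCardVector_eq : upperCardVector = packed fun m => intervalCard m ⊤ := by
  classical
  rw [upperCardVector, listSum_monotoneCodes, packed]
  refine Finset.sum_congr rfl fun m _ => ?_
  change listSum _ _ <<< digitOffset (truthTable m) = _
  rw [Nat.shiftLeft_eq, listSum_codesAbove, intervalCard_eq_sum]
  simp only [le_top, if_true]

theorem digit_intervalVector (s t : MBF₄) :
    digit (intervalVector (truthTable s)) (truthTable t) = intervalCard s t := by
  rw [intervalVector_eq]
  exact digit_packed (fun m => (intervalCard_le s m).trans_lt (by norm_num)) t

theorem digit_upperCardVector (s : MBF₄) :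
    digit upperCardVector (truthTable s) = intervalCard s ⊤ := by
  rw [upperCardVector_eq]
  exact digit_packed (fun m => (intervalCard_le m ⊤).trans_lt (by norm_num)) s

open Classical in
theorem joinVector_eq (s a : MBF₄) :
    joinVector (truthTable s) (truthTable a) = packed fun g => ∑ b, if b ≤ s then
      if a ⊔ b = s then intervalCard ⊥ (a ⊓ b) * intervalCard b g else 0 else 0 := by
  rw [joinVector, listSum_codesBelow, ← packed_sum]
  refine Finset.sum_congr rfl fun b _ => ?_
  rw [← ite_packed, ← ite_packed, ← mul_packed, ← digit_intervalVector ⊥, truthTable_bot, truthTable_inf,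
    ← intervalVector_eq, ← truthTable_sup]
  congr 1
  by_cases h : a ⊔ b = s
  · rw [if_pos h, h, Nat.beq_refl]
    rfl
  · rw [if_neg h, Bool.eq_false_iff.2 fun h' => h (truthTable_injective (Nat.eq_of_beq_eq_true h'))]

open Classical in
theorem digit_lowerVector (s e g : MBF₄) :
    digit (lowerVector (truthTable s) (truthTable e)) (truthTable g) =
      ∑ a, if a ≤ s then intervalCard a e * ∑ b, (if b ≤ s then
        if a ⊔ b = s then intervalCard ⊥ (a ⊓ b) * intervalCard b g else 0 else 0) else 0 := by
  have h : lowerVector (truthTable s) (truthTable e) = packed fun g =>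
      ∑ a, if a ≤ s then intervalCard a e * ∑ b, (if b ≤ s then
        if a ⊔ b = s then intervalCard ⊥ (a ⊓ b) * intervalCard b g else 0 else 0) else 0 := by
    rw [lowerVector, listSum_codesBelow, ← packed_sum]
    refine Finset.sum_congr rfl fun a _ => ?_
    rw [← ite_packed, ← mul_packed, ← joinVector_eq, ← digit_intervalVector]
    rfl
  rw [h, digit_packed]
  intro g
  refine lt_of_le_of_lt (sum_le_mul_of_le (c := 168 * (168 * (168 * 168))) fun a => ?_) (by norm_num)
  split_ifs
  · refine Nat.mul_le_mul (intervalCard_le _ _) (sum_le_mul_of_le fun b => ?_)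
    split_ifs
    · exact Nat.mul_le_mul (intervalCard_le _ _) (intervalCard_le _ _)
    all_goals exact Nat.zero_le _
  · exact Nat.zero_le _

theorem listSum_countWithJoin :
    listSum countWithJoin monotoneCodes = Nat.card (SwapInvariantMap MBF₄) := by
  classical
  have expand (s : MBF₄) : countWithJoin (truthTable s) = ∑ a, ∑ b, ∑ e, ∑ g, if s = a ⊔ b then
      intervalCard ⊥ (a ⊓ b) * (intervalCard (e ⊔ g) ⊤ * (intervalCard a e * (intervalCard b g *
        (intervalCard (a ⊔ b) (e ⊓ g) * intervalCard (a ⊔ b) (e ⊓ g))))) else 0 := by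
    rw [countWithJoin, listSum_codesAbove, sum_sum_sum_sum_comm]
    refine Finset.sum_congr rfl fun e _ => ?_
    rw [listSum_codesAbove]
    by_cases hse : s ≤ e
    swap
    · rw [if_neg hse]
      symm
      refine Finset.sum_eq_zero fun g _ => Finset.sum_eq_zero fun a _ =>
        Finset.sum_eq_zero fun b _ => ?_
      split_ifs with h
      · rw [← h, intervalCard_eq_zero fun h' => hse (h'.trans inf_le_left)]
        simp only [mul_zero]
      · rfl
    rw [if_pos hse]
    refine Finset.sum_congr rfl fun g _ => ?_
    by_cases hsg : s ≤ g
    swap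
    · rw [if_neg hsg]
      symm
      refine Finset.sum_eq_zero fun a _ => Finset.sum_eq_zero fun b _ => ?_
      split_ifs with h
      · rw [← h, intervalCard_eq_zero fun h' => hsg (h'.trans inf_le_right)]
        simp only [mul_zero]
      · rfl
    rw [if_pos hsg, ← truthTable_sup, ← truthTable_inf, digit_upperCardVector,
      digit_intervalVector, digit_lowerVector]
    simp only [Nat.mul_eq]
    rw [Finset.mul_sum, Finset.mul_sum]
    refine Finset.sum_congr rfl fun a _ => ?_
    by_cases has : a ≤ s
    swap
    · rw [if_neg has, mul_zero, mul_zero]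
      symm
      refine Finset.sum_eq_zero fun b _ => if_neg ?_
      rintro rfl
      exact has le_sup_left
    rw [if_pos has, Finset.mul_sum, Finset.mul_sum, Finset.mul_sum]
    refine Finset.sum_congr rfl fun b _ => ?_
    by_cases hs : s = a ⊔ b
    · subst hs
      rw [if_pos rfl, if_pos rfl, if_pos le_sup_right]
      ring
    · rw [if_neg hs, if_neg (Ne.symm hs), ite_self]
      simp only [mul_zero]
  rw [listSum_monotoneCodes, card_swapInvariantMap]
  simp only [expand]
  rw [Finset.sum_comm]
  refine Finset.sum_congr rfl fun a _ => ?_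
  rw [Finset.sum_comm]
  refine Finset.sum_congr rfl fun b _ => ?_
  rw [Finset.sum_comm]
  refine Finset.sum_congr rfl fun e _ => ?_
  rw [Finset.sum_comm]
  refine Finset.sum_congr rfl fun g _ => ?_
  rw [Finset.sum_ite_eq' Finset.univ, if_pos (Finset.mem_univ _)]
end

/-- The contribution of the joins at the positions from `i` to `i + n - 1` in `monotoneCodes`. -/
noncomputable def partialCount (i n : ℕ) : ℕ :=
  listSum countWithJoin ((monotoneCodes.drop i).take n)

theorem partialCount_add (i m n : ℕ) :
    partialCount i (m + n) = partialCount i m + partialCount (i + m) n := by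
  simp only [partialCount, listSum_eq, List.take_add, List.drop_drop, List.map_append,
    List.sum_append]

theorem partialCount_0 : partialCount 0 7 = 20066457232585 :=
  Nat.eq_of_beq_eq_true (by decide +kernel)

theorem partialCount_7 : partialCount 7 14 = 31078398537431 :=
  Nat.eq_of_beq_eq_true (by decide +kernel)

theorem partialCount_21 : partialCount 21 14 = 32857467267916 :=
  Nat.eq_of_beq_eq_true (by decide +kernel)

theorem partialCount_35 : partialCount 35 20 = 68511514817014 :=
  Nat.eq_of_beq_eq_true (by decide +kernel)

theorem partialCount_55 : partialCount 55 34 = 15163207970942 :=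
  Nat.eq_of_beq_eq_true (by decide +kernel)

theorem partialCount_89 : partialCount 89 37 = 13807070194103 :=
  Nat.eq_of_beq_eq_true (by decide +kernel)

theorem partialCount_126 : partialCount 126 24 = 1231094607089 :=
  Nat.eq_of_beq_eq_true (by decide +kernel)

theorem partialCount_150 : partialCount 150 18 = 40230882644 :=
  Nat.eq_of_beq_eq_true (by decide +kernel)

theorem listSum_countWithJoin_monotoneCodes :
    listSum countWithJoin monotoneCodes = 182755441509724 := by
  change partialCount 0 (7 + 14 + 14 + 20 + 34 + 37 + 24 + 18) = _
  rw [partialCount_add, partialCount_add, partialCount_add, partialCount_add, partialCount_add,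
    partialCount_add, partialCount_add]
  simp only [zero_add, Nat.reduceAdd, partialCount_0, partialCount_7, partialCount_21,
    partialCount_35, partialCount_55, partialCount_89, partialCount_126, partialCount_150]

/-- The number of monotone Boolean functions of 8 variables fixed by the
permutation (0 1)(2 3) equals 182755441509724. -/
theorem card_fixed_mbf :
    Nat.card {f : (Fin 8 → Bool) → Bool //
      Monotone f ∧ ∀ x : Fin 8 → Bool, f (x ∘ (Equiv.swap 0 1 * Equiv.swap 2 3 : Equiv.Perm (Fin 8))) = f x} = 182755441509724 := by
  have := DFunLike.finite MBF₄
  have := Fintype.ofFinite MBF₄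
  rw [Nat.card_congr fixedEquivSwapInvariantMap, ← listSum_countWithJoin,
    listSum_countWithJoin_monotoneCodes]
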